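/- arXiv:2306.08187 — 7 statements merged into one kernel-verified Lean document; each statement's English description precedes it below -/
import Mathlib

section
/- Let n ≥ 2 and let c : Fin (n-1) → ℝ be positive edge weights on the path P_n, with Laplacian L. If u ∈ ℝ^n is an eigenvector of L corresponding to the second smallest eigenvalue λ₂ of L (a Fiedler vector), then u is strictly monotone: either u_1 < u_2 < ⋯ < u_n or u_1 > u_2 > ⋯ > u_n. -/
open Finset in
/-- Partial sums of the eigenvector equation of a weighted path. -/
theorem mul_sum_eq_flux_of_path_eigen {n : ℕ} {c u : ℕ → ℝ} {μ : ℝ} (hc0 : c 0 = 0)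
    (heig : ∀ j ∈ Icc 1 n, c (j - 1) * (u j - u (j - 1)) + c j * (u j - u (j + 1)) = μ * u j)
    {k : ℕ} (hk : k ≤ n) : μ * ∑ j ∈ Icc 1 k, u j = c k * (u k - u (k + 1)) := by
  induction k with
  | zero => simp [hc0]
  | succ k ih =>
    have h := heig (k + 1) (mem_Icc.2 ⟨by omega, hk⟩)
    rw [Nat.add_sub_cancel] at h
    rw [sum_Icc_succ_top (by omega), mul_add, ih (by omega)]
    linarith

open Finset in
/-- Summation by parts for the eigenvector equation of a weighted path. -/
theorem mul_sum_sq_eq_energy_add_of_path_eigen {n : ℕ} {c u : ℕ → ℝ} {μ : ℝ} (hc0 : c 0 = 0)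
    (heig : ∀ j ∈ Icc 1 n, c (j - 1) * (u j - u (j - 1)) + c j * (u j - u (j + 1)) = μ * u j)
    {k : ℕ} (hk : k ≤ n) :
    μ * ∑ j ∈ Icc 1 k, u j ^ 2 =
      ∑ i ∈ Icc 1 k, c i * (u i - u (i + 1)) ^ 2 + c k * (u k - u (k + 1)) * u (k + 1) := by
  induction k with
  | zero => simp [hc0]
  | succ k ih =>
    have h := heig (k + 1) (mem_Icc.2 ⟨by omega, hk⟩)
    rw [Nat.add_sub_cancel] at h
    rw [sum_Icc_succ_top (by omega), sum_Icc_succ_top (by omega), mul_add, ih (by omega)]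
    linear_combination (-u (k + 1)) * h

open Finset in
/-- The sum of the squared differences over all pairs of indices. -/
theorem sum_sum_sub_sq {ι : Type*} (s : Finset ι) (x : ι → ℝ) :
    ∑ i ∈ s, ∑ j ∈ s, (x i - x j) ^ 2 =
      2 * (#s : ℝ) * ∑ i ∈ s, x i ^ 2 - 2 * (∑ i ∈ s, x i) ^ 2 := by
  simp only [sub_sq, sum_add_distrib, sum_sub_distrib, sum_const, nsmul_eq_mul, ← mul_sum,
    ← sum_mul]
  ring

/-- The total variation of a sequence on an initial segment. -/
def totalVariation (u : ℕ → ℝ) (k : ℕ) : ℝ := ∑ i ∈ Finset.range k, |u (i + 1) - u i|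

theorem totalVariation_succ (u : ℕ → ℝ) (k : ℕ) :
    totalVariation u (k + 1) = totalVariation u k + |u (k + 1) - u k| :=
  Finset.sum_range_succ _ _

theorem monotone_totalVariation_sub (u : ℕ → ℝ) : Monotone fun k ↦ totalVariation u k - u k :=
  monotone_nat_of_le_succ fun k ↦ by
    have := le_abs_self (u (k + 1) - u k)
    rw [totalVariation_succ]
    linarith

theorem monotone_totalVariation_add (u : ℕ → ℝ) : Monotone fun k ↦ totalVariation u k + u k :=
  monotone_nat_of_le_succ fun k ↦ by
    have := neg_abs_le (u (k + 1) - u k)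
    rw [totalVariation_succ]
    linarith

theorem sub_sq_le_totalVariation_sub_sq (u : ℕ → ℝ) (i j : ℕ) :
    (u i - u j) ^ 2 ≤ (totalVariation u i - totalVariation u j) ^ 2 := by
  wlog h : i ≤ j generalizing i j
  · rw [sub_sq_comm (u i), sub_sq_comm (totalVariation u i)]
    exact this j i (le_of_not_ge h)
  have h₁ := monotone_totalVariation_sub u h
  have h₂ := monotone_totalVariation_add u h
  rw [sub_sq_comm (u i), sub_sq_comm (totalVariation u i)]
  exact sq_le_sq.2 ((abs_le.2 ⟨by linarith, by linarith⟩).trans (le_abs_self _))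

open Finset in
/-- A vector with zero sum that is constant along every edge of a path vanishes. -/
theorem eq_zero_of_path_const {n : ℕ} {x : ℕ → ℝ} (hx : ∀ i ∈ Icc 1 (n - 1), x i = x (i + 1))
    (hsum : ∑ j ∈ Icc 1 n, x j = 0) {j : ℕ} (hj : j ∈ Icc 1 n) : x j = 0 := by
  have hconst : ∀ k, k + 1 ≤ n → x (k + 1) = x 1 := by
    intro k
    induction k with
    | zero => simp
    | succ k ih =>
      intro hk
      rw [← hx (k + 1) (mem_Icc.2 ⟨by omega, by omega⟩), ih (by omega)]
  have hall : ∀ i ∈ Icc 1 n, x i = x 1 := fun i hi ↦ by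
    obtain ⟨h₁, h₂⟩ := mem_Icc.1 hi
    obtain ⟨k, rfl⟩ := Nat.exists_eq_add_of_le' h₁
    exact hconst k h₂
  have hn : n ≠ 0 := by
    have := mem_Icc.1 hj
    omega
  rw [sum_congr rfl hall, sum_const, nsmul_eq_mul, Nat.card_Icc] at hsum
  rw [hall j hj]
  simpa [hn] using hsum

open Finset in
/-- A monotone vector whose sum and whose `k`-th partial sum vanish increases strictly at `k`,
unless it is zero. -/
theorem lt_succ_of_monotoneOn_of_sum_eq_zero {n k : ℕ} {u : ℕ → ℝ}
    (hmono : MonotoneOn u (Set.Icc 1 n)) (hk : k ∈ Icc 1 (n - 1))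
    (hsum : ∑ j ∈ Icc 1 n, u j = 0) (hu : ∃ j ∈ Icc 1 n, u j ≠ 0)
    (hpart : u k = u (k + 1) → ∑ j ∈ Icc 1 k, u j = 0) : u k < u (k + 1) := by
  obtain ⟨hk₁, hk₂⟩ := mem_Icc.1 hk
  refine (hmono ⟨hk₁, by omega⟩ ⟨by omega, by omega⟩ (Nat.le_succ k)).lt_of_ne fun heq ↦ ?_
  have hlow := hpart heq
  have hsplit : ∑ j ∈ Icc 1 k, u j + ∑ j ∈ Icc (k + 1) n, u j = ∑ j ∈ Icc 1 n, u j := by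
    rw [← sum_union (disjoint_left.2 fun a ha hb ↦ by simp only [mem_Icc] at ha hb; omega)]
    congr 1
    ext a
    simp only [mem_union, mem_Icc]
    omega
  have hhigh : ∑ j ∈ Icc (k + 1) n, u j = 0 := by linarith
  have hle : ∀ j ∈ Icc 1 k, u j ≤ u k := fun j hj ↦ by
    obtain ⟨h₁, h₂⟩ := mem_Icc.1 hj
    exact hmono ⟨h₁, by omega⟩ ⟨hk₁, by omega⟩ h₂
  have hge : ∀ j ∈ Icc (k + 1) n, u k ≤ u j := fun j hj ↦ by
    obtain ⟨h₁, h₂⟩ := mem_Icc.1 hj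
    exact hmono ⟨hk₁, by omega⟩ ⟨by omega, h₂⟩ (by omega)
  have hzero : u k = 0 := by
    apply le_antisymm
    · by_contra! h
      exact (sum_pos (fun j hj ↦ h.trans_le (hge j hj))
        ⟨k + 1, mem_Icc.2 ⟨le_rfl, by omega⟩⟩).ne' hhigh
    · by_contra! h
      exact (sum_neg (fun j hj ↦ (hle j hj).trans_lt h) ⟨k, mem_Icc.2 ⟨hk₁, le_rfl⟩⟩).ne hlow
  rw [hzero] at hle hge
  obtain ⟨j, hj, hne⟩ := hu
  obtain ⟨h₁, h₂⟩ := mem_Icc.1 hj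
  rcases le_or_gt j k with h | h
  · exact hne ((sum_eq_zero_iff_of_nonpos hle).1 hlow j (mem_Icc.2 ⟨h₁, h⟩))
  · exact hne ((sum_eq_zero_iff_of_nonneg hge).1 hhigh j (mem_Icc.2 ⟨h, h₂⟩))

open Finset in
/-- If a zero-sum vector has at least the norm of its total variation, shifted to have zero sum,
then the total variation is attained between the endpoints. -/
theorem totalVariation_sub_sq_eq {n : ℕ} (hn : 1 ≤ n) {u : ℕ → ℝ} {a : ℝ}
    (hsum : ∑ j ∈ Icc 1 n, u j = 0) (hsumx : ∑ j ∈ Icc 1 n, (totalVariation u j - a) = 0)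
    (hle : ∑ j ∈ Icc 1 n, (totalVariation u j - a) ^ 2 ≤ ∑ j ∈ Icc 1 n, u j ^ 2) :
    (u n - u 1) ^ 2 = (totalVariation u n - totalVariation u 1) ^ 2 := by
  have hu := sum_sum_sub_sq (Icc 1 n) u
  have hx := sum_sum_sub_sq (Icc 1 n) fun j ↦ totalVariation u j - a
  simp only [sub_sub_sub_cancel_right] at hx
  rw [hsum] at hu
  rw [hsumx] at hx
  have hterm : ∀ i ∈ Icc 1 n, ∑ j ∈ Icc 1 n, (u i - u j) ^ 2 ≤
      ∑ j ∈ Icc 1 n, (totalVariation u i - totalVariation u j) ^ 2 :=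
    fun i _ ↦ sum_le_sum fun j _ ↦ sub_sq_le_totalVariation_sub_sq u i j
  have heq : ∑ i ∈ Icc 1 n, ∑ j ∈ Icc 1 n, (u i - u j) ^ 2 =
      ∑ i ∈ Icc 1 n, ∑ j ∈ Icc 1 n, (totalVariation u i - totalVariation u j) ^ 2 := by
    refine (sum_le_sum hterm).antisymm ?_
    rw [hu, hx]
    gcongr
  have h₁ := (sum_eq_sum_iff_of_le hterm).1 heq n (mem_Icc.2 ⟨hn, le_rfl⟩)
  exact (sum_eq_sum_iff_of_le fun j _ ↦ sub_sq_le_totalVariation_sub_sq u n j).1 h₁ 1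
    (mem_Icc.2 ⟨le_rfl, hn⟩)

open Finset in
/-- The total variation of a zero-sum vector, shifted to have zero sum, has at least the norm of
that vector. -/
theorem sum_sq_le_sum_totalVariation_sq {n : ℕ} (hn : 1 ≤ n) {u : ℕ → ℝ} {a : ℝ}
    (hsum : ∑ j ∈ Icc 1 n, u j = 0) (hsumx : ∑ j ∈ Icc 1 n, (totalVariation u j - a) = 0) :
    ∑ j ∈ Icc 1 n, u j ^ 2 ≤ ∑ j ∈ Icc 1 n, (totalVariation u j - a) ^ 2 := by
  have hu := sum_sum_sub_sq (Icc 1 n) u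
  have hx := sum_sum_sub_sq (Icc 1 n) fun j ↦ totalVariation u j - a
  simp only [sub_sub_sub_cancel_right] at hx
  rw [hsum] at hu
  rw [hsumx] at hx
  have hle := sum_le_sum fun i (_ : i ∈ Icc 1 n) ↦ sum_le_sum fun j (_ : j ∈ Icc 1 n) ↦
    sub_sq_le_totalVariation_sub_sq u i j
  rw [hu, hx] at hle
  have hpos : 0 < 2 * (#(Icc 1 n) : ℝ) := by
    rw [Nat.card_Icc]
    have : (0 : ℝ) < ((n + 1 - 1 : ℕ) : ℝ) := by exact_mod_cast (by omega)
    positivity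
  exact le_of_mul_le_mul_left (by linarith) hpos

/-- A sequence whose total variation is attained between the endpoints is monotone there. -/
theorem monotoneOn_or_antitoneOn_of_totalVariation {n : ℕ} {u : ℕ → ℝ}
    (h : (u n - u 1) ^ 2 = (totalVariation u n - totalVariation u 1) ^ 2) :
    MonotoneOn u (Set.Icc 1 n) ∨ AntitoneOn u (Set.Icc 1 n) := by
  have hmono : Monotone (totalVariation u) := monotone_nat_of_le_succ fun k ↦ by
    rw [totalVariation_succ]
    exact le_add_of_nonneg_right (abs_nonneg _)
  rcases sq_eq_sq_iff_eq_or_eq_neg.1 h with h | h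
  · have hconst : ∀ k ∈ Set.Icc 1 n, totalVariation u k - u k = totalVariation u 1 - u 1 :=
      fun k hk ↦ by
        have h₁ := monotone_totalVariation_sub u hk.1
        have h₂ := monotone_totalVariation_sub u hk.2
        dsimp only at h₁ h₂
        linarith
    refine .inl fun i hi j hj hij ↦ ?_
    linarith [hconst i hi, hconst j hj, hmono hij]
  · have hconst : ∀ k ∈ Set.Icc 1 n, totalVariation u k + u k = totalVariation u 1 + u 1 :=
      fun k hk ↦ by
        have h₁ := monotone_totalVariation_add u hk.1
        have h₂ := monotone_totalVariation_add u hk.2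
        dsimp only at h₁ h₂
        linarith
    refine .inr fun i hi j hj hij ↦ ?_
    linarith [hconst i hi, hconst j hj, hmono hij]

/-- **Fiedler vectors of weighted paths are strictly monotone.**
The path `Pₙ` has vertices `v_1, …, v_n` and positive edge weights
`c i = ω(v_i, v_{i+1})` for `i = 1, …, n-1` (with the conventions `c 0 = c n = 0`,
so that the Laplacian acts by `(Lx)_j = c_{j-1}(x_j - x_{j-1}) + c_j (x_j - x_{j+1})`
for `j = 1, …, n`).  If `u` is an eigenvector of the Laplacian for the eigenvalue `μ = λ₂`,
the second smallest eigenvalue (characterized variationally as the minimum of the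
Rayleigh quotient over nonzero vectors orthogonal to the all-ones vector), then `u`
is either strictly increasing or strictly decreasing. -/
theorem fiedler_vector_of_path_strictly_monotone
    (n : ℕ) (hn : 2 ≤ n) (c : ℕ → ℝ)
    (hc : ∀ i ∈ Finset.Icc 1 (n - 1), 0 < c i) (hc0 : c 0 = 0) (hcn : c n = 0)
    (u : ℕ → ℝ) (μ : ℝ)
    (heig : ∀ j ∈ Finset.Icc 1 n,
      c (j - 1) * (u j - u (j - 1)) + c j * (u j - u (j + 1)) = μ * u j)
    (hu : ∃ j ∈ Finset.Icc 1 n, u j ≠ 0)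
    (hμ : IsLeast {R : ℝ | ∃ x : ℕ → ℝ, (∃ j ∈ Finset.Icc 1 n, x j ≠ 0) ∧
        (∑ j ∈ Finset.Icc 1 n, x j) = 0 ∧
        R = (∑ i ∈ Finset.Icc 1 (n - 1), c i * (x i - x (i + 1)) ^ 2) /
            (∑ j ∈ Finset.Icc 1 n, (x j) ^ 2)} μ) :
    (∀ j ∈ Finset.Icc 1 (n - 1), u j < u (j + 1)) ∨
    (∀ j ∈ Finset.Icc 1 (n - 1), u (j + 1) < u j) := by
  obtain ⟨hmem, hmin⟩ := hμ
  have hpos : 0 < μ := by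
    obtain ⟨x, ⟨j, hj, hne⟩, hsum, rfl⟩ := hmem
    have hterm : ∀ i ∈ Finset.Icc 1 (n - 1), 0 ≤ c i * (x i - x (i + 1)) ^ 2 :=
      fun i hi ↦ mul_nonneg (hc i hi).le (sq_nonneg _)
    refine div_pos ((Finset.sum_nonneg hterm).lt_of_ne' fun h ↦ ?_)
      (Finset.sum_pos' (fun i _ ↦ sq_nonneg _) ⟨j, hj, by positivity⟩)
    refine hne (eq_zero_of_path_const (fun i hi ↦ ?_) hsum hj)
    have h₀ := (Finset.sum_eq_zero_iff_of_nonneg hterm).1 h i hi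
    simpa [(hc i hi).ne', sub_eq_zero] using h₀
  have hsum : ∑ j ∈ Finset.Icc 1 n, u j = 0 := by
    have h := mul_sum_eq_flux_of_path_eigen hc0 heig le_rfl
    rw [hcn, zero_mul] at h
    exact (mul_eq_zero.1 h).resolve_left hpos.ne'
  have hnorm : 0 < ∑ j ∈ Finset.Icc 1 n, u j ^ 2 := by
    obtain ⟨j, hj, hne⟩ := hu
    exact Finset.sum_pos' (fun i _ ↦ sq_nonneg _) ⟨j, hj, by positivity⟩
  have henergy : ∑ i ∈ Finset.Icc 1 (n - 1), c i * (u i - u (i + 1)) ^ 2 =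
      μ * ∑ j ∈ Finset.Icc 1 n, u j ^ 2 := by
    rw [mul_sum_sq_eq_energy_add_of_path_eigen hc0 heig le_rfl, hcn]
    obtain ⟨m, rfl⟩ : ∃ m, n = m + 1 := ⟨n - 1, by omega⟩
    rw [Finset.sum_Icc_succ_top (by omega), hcn]
    simp
  obtain ⟨a, ha⟩ : ∃ a, ∑ j ∈ Finset.Icc 1 n, (totalVariation u j - a) = 0 := by
    have hn₀ : (n : ℝ) ≠ 0 := by exact_mod_cast (by omega)
    refine ⟨(∑ j ∈ Finset.Icc 1 n, totalVariation u j) / n, ?_⟩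
    rw [Finset.sum_sub_distrib, Finset.sum_const, nsmul_eq_mul, Nat.card_Icc,
      Nat.add_sub_cancel, mul_div_cancel₀ _ hn₀, sub_self]
  have hnorm' := hnorm.trans_le (sum_sq_le_sum_totalVariation_sq (by omega) hsum ha)
  have hray := hmin ⟨fun j ↦ totalVariation u j - a, by
    by_contra! h
    exact hnorm'.ne' (Finset.sum_eq_zero fun j hj ↦ by rw [h j hj, sq, zero_mul]), ha, rfl⟩
  have henergy' : ∀ i, (totalVariation u i - a - (totalVariation u (i + 1) - a)) ^ 2 =
      (u i - u (i + 1)) ^ 2 := fun i ↦ by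
    rw [totalVariation_succ, sub_sq_comm (u i), ← sq_abs (u (i + 1) - u i)]
    ring
  simp only [henergy'] at hray
  rw [henergy, le_div_iff₀ hnorm'] at hray
  have hend := totalVariation_sub_sq_eq (by omega) hsum ha (le_of_mul_le_mul_left hray hpos)
  have hpart : ∀ k ∈ Finset.Icc 1 (n - 1), u k = u (k + 1) →
      ∑ j ∈ Finset.Icc 1 k, u j = 0 := fun k hk h ↦ by
    have hk₂ := (Finset.mem_Icc.1 hk).2
    have h' := mul_sum_eq_flux_of_path_eigen hc0 heig (show k ≤ n by omega)
    rw [h, sub_self, mul_zero] at h'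
    exact (mul_eq_zero.1 h').resolve_left hpos.ne'
  rcases monotoneOn_or_antitoneOn_of_totalVariation hend with h | h
  · exact .inl fun k hk ↦ lt_succ_of_monotoneOn_of_sum_eq_zero h hk hsum hu (hpart k hk)
  · refine .inr fun k hk ↦ neg_lt_neg_iff.1 <|
      lt_succ_of_monotoneOn_of_sum_eq_zero (u := fun j ↦ -u j) h.neg hk ?_ ?_ fun heq ↦ ?_
    · simp [hsum]
    · simpa using hu
    · rw [Finset.sum_neg_distrib, hpart k hk (neg_injective heq), neg_zero]
end

section
/- Let n ≥ 2 be even and let c : Fin (n-1) → ℝ be positive edge weights on the path P_n that are symmetric, i.e. c_i = c_{n-i} for all i = 1,…,n-1, and let L be the Laplacian. If x ∈ ℝ^n is an eigenvector of L corresponding to the second smallest eigenvalue λ₂ of L (a Fiedler vector), then x_j + x_{n+1-j} = 0 for all j = 1,…,n. -/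
/-- Reflecting the index `j ↦ N - j` in a sum over `1, …, m`. -/
theorem sum_Icc_one_reflect (f : ℕ → ℝ) {m N : ℕ} (h : m < N) :
    ∑ j ∈ Finset.Icc 1 m, f (N - j) = ∑ j ∈ Finset.Icc (N - m) (N - 1), f j := by
  refine Finset.sum_nbij' (fun j => N - j) (fun j => N - j) ?_ ?_ ?_ ?_ ?_ <;>
    simp only [Finset.mem_Icc, implies_true] <;> omega

/-- Splitting a sum over `1, …, b` after the index `a`. -/
theorem sum_Icc_one_split (f : ℕ → ℝ) {a b : ℕ} (h : a ≤ b) :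
    ∑ j ∈ Finset.Icc 1 b, f j
      = ∑ j ∈ Finset.Icc 1 a, f j + ∑ j ∈ Finset.Icc (a + 1) b, f j := by
  rw [← Finset.sum_union]
  · congr 1
    ext j
    simp only [Finset.mem_union, Finset.mem_Icc]
    omega
  · rw [Finset.disjoint_left]
    intro j
    simp only [Finset.mem_Icc]
    omega

/-- Summing the eigenvalue equation over the first `k` vertices of a weighted path. -/
theorem path_flux_eq (c z : ℕ → ℝ) (μ : ℝ) (hc0 : c 0 = 0) (k : ℕ)
    (h : ∀ j ∈ Finset.Icc 1 k,
      c (j - 1) * (z j - z (j - 1)) + c j * (z j - z (j + 1)) = μ * z j) :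
    c k * (z k - z (k + 1)) = μ * ∑ j ∈ Finset.Icc 1 k, z j := by
  induction k with
  | zero => simp [hc0]
  | succ k ih =>
    have hk := ih fun j hj => h j (Finset.Icc_subset_Icc_right k.le_succ hj)
    have hlast := h (k + 1) (by simp)
    rw [Nat.add_sub_cancel] at hlast
    rw [Finset.sum_Icc_succ_top (by omega)]
    linear_combination hlast + hk

/-- Discrete Green's formula for an eigenvector on the first `k + 1` vertices of a weighted
path. -/
theorem path_energy_eq (c z : ℕ → ℝ) (μ : ℝ) (hc0 : c 0 = 0) (k : ℕ)
    (h : ∀ j ∈ Finset.Icc 1 (k + 1),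
      c (j - 1) * (z j - z (j - 1)) + c j * (z j - z (j + 1)) = μ * z j) :
    ∑ i ∈ Finset.Icc 1 k, c i * (z i - z (i + 1)) ^ 2
        + c (k + 1) * (z (k + 1) - z (k + 2)) * z (k + 1)
      = μ * ∑ j ∈ Finset.Icc 1 (k + 1), z j ^ 2 := by
  induction k with
  | zero =>
    have h1 := h 1 (by simp)
    simp only [Nat.sub_self, hc0] at h1
    simp only [Finset.Icc_self, Finset.sum_singleton, zero_add]
    rw [Finset.Icc_eq_empty (by omega), Finset.sum_empty]
    linear_combination z 1 * h1
  | succ k ih =>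
    have hk := ih fun j hj => h j (Finset.Icc_subset_Icc_right (k + 1).le_succ hj)
    have hlast := h (k + 2) (by simp)
    rw [show k + 2 - 1 = k + 1 by omega] at hlast
    rw [Finset.sum_Icc_succ_top (by omega), Finset.sum_Icc_succ_top (by omega : 1 ≤ k + 1 + 1)]
    linear_combination z (k + 2) * hlast + hk

/-- An eigenvector of a weighted path which vanishes at two consecutive vertices vanishes at all
preceding vertices. -/
theorem path_eigenvector_eq_zero (c z : ℕ → ℝ) (μ : ℝ) (m : ℕ)
    (hc : ∀ i, 1 ≤ i → i < m → c i ≠ 0)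
    (h : ∀ j ∈ Finset.Icc 1 m,
      c (j - 1) * (z j - z (j - 1)) + c j * (z j - z (j + 1)) = μ * z j)
    (hm : z m = 0) (hm' : z (m + 1) = 0) :
    ∀ j, 1 ≤ j → j ≤ m → z j = 0 := by
  have key : ∀ d j, j + d = m → 1 ≤ j → z j = 0 ∧ z (j + 1) = 0 := by
    intro d
    induction d with
    | zero =>
      rintro j rfl -
      exact ⟨hm, hm'⟩
    | succ d ih =>
      intro j hj hj1
      obtain ⟨h1, h2⟩ := ih (j + 1) (by omega) (by omega)
      have he := h (j + 1) (by simp only [Finset.mem_Icc]; omega)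
      rw [Nat.add_sub_cancel, h1, h2] at he
      have : c j * z j = 0 := by linear_combination -he
      exact ⟨(mul_eq_zero.mp this).resolve_left (hc j hj1 (by omega)), h1⟩
  exact fun j hj hjm => (key (m - j) j (by omega) hj).1

/-- The Dirichlet energy of a nonzero mean-zero vector on a positively weighted path is
positive. -/
theorem path_energy_pos (n : ℕ) (c y : ℕ → ℝ) (hc : ∀ i ∈ Finset.Icc 1 (n - 1), 0 < c i)
    (hy : ∃ j ∈ Finset.Icc 1 n, y j ≠ 0) (hsum : ∑ j ∈ Finset.Icc 1 n, y j = 0) :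
    0 < ∑ i ∈ Finset.Icc 1 (n - 1), c i * (y i - y (i + 1)) ^ 2 := by
  have hnonneg : ∀ i ∈ Finset.Icc 1 (n - 1), 0 ≤ c i * (y i - y (i + 1)) ^ 2 :=
    fun i hi => mul_nonneg (hc i hi).le (sq_nonneg _)
  refine (Finset.sum_nonneg hnonneg).lt_of_ne' fun h0 => ?_
  rw [Finset.sum_eq_zero_iff_of_nonneg hnonneg] at h0
  have hconst : ∀ j, 1 ≤ j → j ≤ n → y j = y 1 := by
    intro j hj
    induction j, hj using Nat.le_induction with
    | base => exact fun _ => rfl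
    | succ j hj ih =>
      intro hjn
      have hmem : j ∈ Finset.Icc 1 (n - 1) := by simp only [Finset.mem_Icc]; omega
      have hsq := (mul_eq_zero.mp (h0 j hmem)).resolve_left (hc j hmem).ne'
      linarith [ih (by omega), pow_eq_zero_iff two_ne_zero |>.mp hsq]
  have hconst' : ∀ j ∈ Finset.Icc 1 n, y j = y 1 := fun j hj =>
    hconst j (Finset.mem_Icc.mp hj).1 (Finset.mem_Icc.mp hj).2
  obtain ⟨j, hj, hne⟩ := hy
  have hn : (n : ℝ) ≠ 0 := by
    rw [Nat.cast_ne_zero]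
    have := Finset.mem_Icc.mp hj
    omega
  rw [Finset.sum_congr rfl hconst', Finset.sum_const, Nat.card_Icc, nsmul_eq_mul,
    Nat.add_sub_cancel] at hsum
  exact hne ((hconst' j hj).trans ((mul_eq_zero.mp hsum).resolve_left hn))

/-- **Antisymmetry of Fiedler vectors of symmetrically weighted paths of even length.**
The path `Pₙ` (with `n` even) has vertices `v_1, …, v_n` and positive edge weights
`c i = ω(v_i, v_{i+1})` for `i = 1, …, n-1` (with the conventions `c 0 = c n = 0`,
so that the Laplacian acts by `(Lx)_j = c_{j-1}(x_j - x_{j-1}) + c_j (x_j - x_{j+1})`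
for `j = 1, …, n`).  Suppose the weights are symmetric: `c i = c (n - i)` for all
`i = 1, …, n-1`.  If `x` is an eigenvector of the Laplacian for the eigenvalue `μ = λ₂`,
the second smallest eigenvalue (characterized variationally as the minimum of the
Rayleigh quotient over nonzero vectors orthogonal to the all-ones vector), then
`x_j + x_{n+1-j} = 0` for all `j = 1, …, n`. -/
theorem fiedler_vector_of_symmetric_path_antisymmetric
    (n : ℕ) (hn : 2 ≤ n) (hneven : Even n) (c : ℕ → ℝ)
    (hc : ∀ i ∈ Finset.Icc 1 (n - 1), 0 < c i) (hc0 : c 0 = 0) (hcn : c n = 0)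
    (hsymm : ∀ i ∈ Finset.Icc 1 (n - 1), c i = c (n - i))
    (x : ℕ → ℝ) (μ : ℝ)
    (heig : ∀ j ∈ Finset.Icc 1 n,
      c (j - 1) * (x j - x (j - 1)) + c j * (x j - x (j + 1)) = μ * x j)
    (hx : ∃ j ∈ Finset.Icc 1 n, x j ≠ 0)
    (hμ : IsLeast {R : ℝ | ∃ y : ℕ → ℝ, (∃ j ∈ Finset.Icc 1 n, y j ≠ 0) ∧
        (∑ j ∈ Finset.Icc 1 n, y j) = 0 ∧
        R = (∑ i ∈ Finset.Icc 1 (n - 1), c i * (y i - y (i + 1)) ^ 2) /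
            (∑ j ∈ Finset.Icc 1 n, (y j) ^ 2)} μ) :
    ∀ j ∈ Finset.Icc 1 n, x j + x (n + 1 - j) = 0 := by
  obtain ⟨k, rfl⟩ : ∃ k, n = 2 * (k + 1) := by
    obtain ⟨r, hr⟩ := hneven
    exact ⟨r - 1, by omega⟩
  have hsymm' : ∀ i j, i + j = 2 * (k + 1) → c i = c j := by
    intro i j hij
    rcases Nat.eq_zero_or_pos i with rfl | hi
    · rw [hc0, show j = 2 * (k + 1) by omega, hcn]
    rcases Nat.eq_zero_or_pos j with rfl | hj
    · rw [hc0, show i = 2 * (k + 1) by omega, hcn]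
    rw [hsymm i (by simp only [Finset.mem_Icc]; omega), show 2 * (k + 1) - i = j by omega]
  have hμpos : 0 < μ := by
    obtain ⟨y, hy, hsum, rfl⟩ := hμ.1
    refine div_pos (path_energy_pos _ c y hc hy hsum) ?_
    obtain ⟨j, hj, hne⟩ := hy
    exact Finset.sum_pos' (fun i _ => sq_nonneg _) ⟨j, hj, by positivity⟩
  set z : ℕ → ℝ := fun j => x j + x (2 * (k + 1) + 1 - j) with hz
  have hzrefl : ∀ i j, i + j = 2 * (k + 1) + 1 → z i = z j := by
    intro i j hij
    simp only [hz]
    rw [show 2 * (k + 1) + 1 - i = j by omega, show 2 * (k + 1) + 1 - j = i by omega, add_comm]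
  have hzeig : ∀ j ∈ Finset.Icc 1 (k + 1),
      c (j - 1) * (z j - z (j - 1)) + c j * (z j - z (j + 1)) = μ * z j := by
    intro j hj
    rw [Finset.mem_Icc] at hj
    have h1 := heig j (by simp only [Finset.mem_Icc]; omega)
    have h2 := heig (2 * (k + 1) + 1 - j) (by simp only [Finset.mem_Icc]; omega)
    rw [hsymm' (2 * (k + 1) + 1 - j - 1) j (by omega),
      hsymm' (2 * (k + 1) + 1 - j) (j - 1) (by omega)] at h2
    simp only [hz]
    rw [show 2 * (k + 1) + 1 - (j - 1) = 2 * (k + 1) + 1 - j + 1 by omega,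
      show 2 * (k + 1) + 1 - (j + 1) = 2 * (k + 1) + 1 - j - 1 by omega]
    linear_combination h1 + h2
  have hmid : z (k + 2) = z (k + 1) := hzrefl _ _ (by omega)
  have hzm : z (k + 1) = 0 := by
    by_contra hne
    have hS : ∑ j ∈ Finset.Icc 1 (k + 1), z j = 0 := by
      have hflux := path_flux_eq c z μ hc0 (k + 1) hzeig
      rw [hmid, sub_self, mul_zero] at hflux
      exact (mul_eq_zero.mp hflux.symm).resolve_left hμpos.ne'
    have hE := path_energy_eq c z μ hc0 k hzeig
    rw [hmid, sub_self, mul_zero, zero_mul, add_zero] at hE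
    set a := z (k + 1) with ha
    set Z := ∑ j ∈ Finset.Icc 1 (k + 1), z j ^ 2 with hZ
    -- The test vector: `z - a` on the left half, `a - z` on the right half.
    set y : ℕ → ℝ := fun j => if j ≤ k + 1 then z j - a else a - z j with hy
    have hyl : ∀ j, j ≤ k + 1 → y j = z j - a := fun j hj => if_pos hj
    have hyr : ∀ j, 1 ≤ j → j ≤ k + 1 → y (2 * (k + 1) + 1 - j) = -(z j - a) := by
      intro j hj hj'
      have : ¬ 2 * (k + 1) + 1 - j ≤ k + 1 := by omega
      simp only [hy, if_neg this]
      rw [hzrefl (2 * (k + 1) + 1 - j) j (by omega)]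
      ring
    have hhalf : ∀ f : ℕ → ℝ, ∑ j ∈ Finset.Icc 1 (2 * (k + 1)), f j
        = ∑ j ∈ Finset.Icc 1 (k + 1), (f j + f (2 * (k + 1) + 1 - j)) := by
      intro f
      rw [sum_Icc_one_split f (show k + 1 ≤ 2 * (k + 1) by omega), Finset.sum_add_distrib,
        sum_Icc_one_reflect f (by omega)]
      congr 3
      omega
    have hysum : ∑ j ∈ Finset.Icc 1 (2 * (k + 1)), y j = 0 := by
      rw [hhalf]
      refine Finset.sum_eq_zero fun j hj => ?_
      rw [Finset.mem_Icc] at hj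
      rw [hyl j hj.2, hyr j hj.1 hj.2, add_neg_cancel]
    have hynorm : ∑ j ∈ Finset.Icc 1 (2 * (k + 1)), y j ^ 2 = 2 * (Z + (k + 1) * a ^ 2) := by
      have hterm : ∀ j ∈ Finset.Icc 1 (k + 1), y j ^ 2 + y (2 * (k + 1) + 1 - j) ^ 2
          = 2 * z j ^ 2 - 4 * a * z j + 2 * a ^ 2 := by
        intro j hj
        rw [Finset.mem_Icc] at hj
        rw [hyl j hj.2, hyr j hj.1 hj.2]
        ring
      rw [hhalf fun j => y j ^ 2, Finset.sum_congr rfl hterm, Finset.sum_add_distrib,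
        Finset.sum_sub_distrib, ← Finset.mul_sum, ← Finset.mul_sum, hS, Finset.sum_const,
        Nat.card_Icc, nsmul_eq_mul]
      push_cast [Nat.add_sub_cancel]
      ring
    have hyenergy : ∑ i ∈ Finset.Icc 1 (2 * (k + 1) - 1), c i * (y i - y (i + 1)) ^ 2
        = 2 * (μ * Z) := by
      have hymid : y (k + 1 + 1) = 0 := by
        have := hyr (k + 1) (by omega) le_rfl
        rwa [show 2 * (k + 1) + 1 - (k + 1) = k + 1 + 1 by omega, ← ha, sub_self,
          neg_zero] at this
      have hright := sum_Icc_one_reflect (fun i => c i * (y i - y (i + 1)) ^ 2)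
        (show k < 2 * (k + 1) by omega)
      rw [show 2 * (k + 1) - k = k + 1 + 1 by omega] at hright
      rw [sum_Icc_one_split _ (show k + 1 ≤ 2 * (k + 1) - 1 by omega), ← hright,
        Finset.sum_Icc_succ_top (by omega), hymid, hyl (k + 1) le_rfl, ← ha, ← hE,
        two_mul (Finset.sum _ _), sub_self, sub_zero, zero_pow two_ne_zero, mul_zero, add_zero]
      congr 1 <;> refine Finset.sum_congr rfl fun i hi => ?_ <;> rw [Finset.mem_Icc] at hi
      · rw [hyl i (by omega), hyl (i + 1) (by omega)]
        ring
      · have h1 := hyr (i + 1) (by omega) (by omega)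
        have h2 := hyr i (by omega) (by omega)
        rw [show 2 * (k + 1) + 1 - (i + 1) = 2 * (k + 1) - i by omega] at h1
        rw [show 2 * (k + 1) + 1 - i = 2 * (k + 1) - i + 1 by omega] at h2
        rw [h1, h2, hsymm' (2 * (k + 1) - i) i (by omega)]
        ring
    have hZnonneg : 0 ≤ Z := Finset.sum_nonneg fun j _ => sq_nonneg _
    have hapos : 0 < ((k : ℝ) + 1) * a ^ 2 := by positivity
    have hyne : ∃ j ∈ Finset.Icc 1 (2 * (k + 1)), y j ≠ 0 := by
      by_contra! h
      have h0 : ∑ j ∈ Finset.Icc 1 (2 * (k + 1)), y j ^ 2 = 0 :=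
        Finset.sum_eq_zero fun j hj => by rw [h j hj, zero_pow two_ne_zero]
      linarith
    have hle := hμ.2 ⟨y, hyne, hysum, rfl⟩
    rw [hyenergy, hynorm, le_div_iff₀ (by linarith)] at hle
    nlinarith [mul_pos hμpos hapos]
  have hzero := path_eigenvector_eq_zero c z μ (k + 1)
    (fun i hi hik => (hc i (by simp only [Finset.mem_Icc]; omega)).ne') hzeig hzm
    (hmid.trans hzm)
  intro j hj
  rw [Finset.mem_Icc] at hj
  change z j = 0
  rcases le_or_gt j (k + 1) with h | h
  · exact hzero j hj.1 h
  · rw [hzrefl j (2 * (k + 1) + 1 - j) (by omega)]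
    exact hzero _ (by omega) (by omega)
end

section
/- Let (V, w) be a finite connected weighted graph, and suppose V = A ∪ B where A ∩ B = {v} is a single vertex, and w(i,j) = 0 whenever i ∈ A \ {v} and j ∈ B \ {v} (no edges join A ∖ {v} to B ∖ {v}). Assume the induced weighted graphs on A and on B are connected. Let w₁ ∈ A and w₂ ∈ B with w₁ ≠ v ≠ w₂. Then the effective resistance in (V,w) between w₁ and w₂ satisfies r(w₁,w₂) = ρ₁ + ρ₂, where ρ₁ is the effective resistance between w₁ and v in the induced weighted graph on A, and ρ₂ is the effective resistance between w₂ and v in the induced weighted graph on B. -/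
/-- The Dirichlet energy of `f : V → ℝ` on the weighted graph `(V, w)`:
`E(f) = Σ_{unordered pairs {i,j}} w i j * (f i - f j)²`, written here as half the sum
over ordered pairs (which agrees since `w` is symmetric with zero diagonal). -/
noncomputable def graphEnergy {V : Type*} [Fintype V] (w : V → V → ℝ) (f : V → ℝ) : ℝ :=
  (1 / 2) * ∑ i : V, ∑ j : V, w i j * (f i - f j) ^ 2

/-- A weighted graph is connected if any two vertices are joined by a path of edges
(pairs of positive weight). -/
def IsConnectedW {V : Type*} (w : V → V → ℝ) : Prop :=
  ∀ a b : V, Relation.ReflTransGen (fun i j => 0 < w i j) a b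

/-- The effective resistance between `a` and `b` in the weighted graph `(V, w)`:
`r(a,b)⁻¹ = min { E(f) : f a = 1, f b = 0 }` (for a connected weighted graph the
minimum is attained, positive, and equals the infimum). -/
noncomputable def effRes {V : Type*} [Fintype V] (w : V → V → ℝ) (a b : V) : ℝ :=
  (sInf {e : ℝ | ∃ f : V → ℝ, f a = 1 ∧ f b = 0 ∧ e = graphEnergy w f})⁻¹

/-- The effective conductance between `a` and `b`, the inverse of the effective resistance. -/
noncomputable def effCond {V : Type*} [Fintype V] (w : V → V → ℝ) (a b : V) : ℝ :=
  sInf {e : ℝ | ∃ f : V → ℝ, f a = 1 ∧ f b = 0 ∧ e = graphEnergy w f}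

theorem effRes_eq_inv_effCond {V : Type*} [Fintype V] (w : V → V → ℝ) (a b : V) :
    effRes w a b = (effCond w a b)⁻¹ := rfl

section Energy

variable {V : Type*} [Fintype V] {w : V → V → ℝ}

theorem graphEnergy_nonneg (hw : ∀ i j, 0 ≤ w i j) (f : V → ℝ) : 0 ≤ graphEnergy w f :=
  mul_nonneg (by norm_num) <| Finset.sum_nonneg fun i _ => Finset.sum_nonneg fun j _ =>
    mul_nonneg (hw i j) (sq_nonneg _)

theorem graphEnergy_const_add_mul (w : V → V → ℝ) (c s : ℝ) (f : V → ℝ) :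
    graphEnergy w (fun i => c + s * f i) = s ^ 2 * graphEnergy w f := by
  simp only [graphEnergy, Finset.mul_sum]
  refine Finset.sum_congr rfl fun i _ => Finset.sum_congr rfl fun j _ => ?_
  ring

theorem edge_le_graphEnergy (hw : ∀ i j, 0 ≤ w i j) (f : V → ℝ) (i j : V) :
    w i j * (f i - f j) ^ 2 ≤ 2 * graphEnergy w f := by
  have hnn : ∀ i j, 0 ≤ w i j * (f i - f j) ^ 2 := fun i j => mul_nonneg (hw i j) (sq_nonneg _)
  have h₁ := Finset.single_le_sum (f := fun j => w i j * (f i - f j) ^ 2)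
    (fun j _ => hnn i j) (Finset.mem_univ j)
  have h₂ := Finset.single_le_sum (f := fun i => ∑ j, w i j * (f i - f j) ^ 2)
    (fun i _ => Finset.sum_nonneg fun j _ => hnn i j) (Finset.mem_univ i)
  unfold graphEnergy
  linarith

/-- Along a path of edges, squared potential differences are controlled by the energy. -/
theorem exists_sq_sub_le_graphEnergy (hw : ∀ i j, 0 ≤ w i j) {a b : V}
    (hab : Relation.ReflTransGen (fun i j => 0 < w i j) a b) :
    ∃ K : ℝ, ∀ f : V → ℝ, (f a - f b) ^ 2 ≤ K * graphEnergy w f := by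
  induction hab with
  | refl => exact ⟨0, fun f => by simp⟩
  | @tail b c _ hbc ih =>
    obtain ⟨K, hK⟩ := ih
    refine ⟨2 * K + 4 / w b c, fun f => ?_⟩
    have h₁ : (f b - f c) ^ 2 ≤ 2 * graphEnergy w f / w b c := by
      rw [le_div_iff₀ hbc, mul_comm]
      exact edge_le_graphEnergy hw f b c
    have h₂ : (2 * K + 4 / w b c) * graphEnergy w f
        = 2 * (K * graphEnergy w f) + 2 * (2 * graphEnergy w f / w b c) := by ring
    rw [h₂]
    nlinarith [hK f, sq_nonneg ((f a - f b) - (f b - f c))]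

theorem effCond_le_graphEnergy (hw : ∀ i j, 0 ≤ w i j) {a b : V} {f : V → ℝ}
    (ha : f a = 1) (hb : f b = 0) : effCond w a b ≤ graphEnergy w f :=
  csInf_le ⟨0, by rintro e ⟨g, -, -, rfl⟩; exact graphEnergy_nonneg hw g⟩ ⟨f, ha, hb, rfl⟩

theorem le_effCond {a b : V} (hab : a ≠ b) {c : ℝ}
    (h : ∀ f : V → ℝ, f a = 1 → f b = 0 → c ≤ graphEnergy w f) : c ≤ effCond w a b := by
  classical
  refine le_csInf ⟨_, Pi.single a 1, by simp, by simp [hab.symm], rfl⟩ ?_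
  rintro e ⟨f, ha, hb, rfl⟩
  exact h f ha hb

theorem exists_graphEnergy_lt {a b : V} (hab : a ≠ b) {c : ℝ} (hc : effCond w a b < c) :
    ∃ f : V → ℝ, f a = 1 ∧ f b = 0 ∧ graphEnergy w f < c := by
  by_contra! h
  exact hc.not_ge (le_effCond hab h)

theorem effCond_mul_sq_le_graphEnergy (hw : ∀ i j, 0 ≤ w i j) (a b : V) (f : V → ℝ) :
    effCond w a b * (f a - f b) ^ 2 ≤ graphEnergy w f := by
  rcases eq_or_ne (f a - f b) 0 with h | h
  · simpa [h] using graphEnergy_nonneg hw f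
  · have key := effCond_le_graphEnergy hw (a := a) (b := b)
      (f := fun i => -(f b / (f a - f b)) + (f a - f b)⁻¹ * f i)
      (by field_simp; ring) (by field_simp; ring)
    rw [graphEnergy_const_add_mul] at key
    calc effCond w a b * (f a - f b) ^ 2
        ≤ ((f a - f b)⁻¹ ^ 2 * graphEnergy w f) * (f a - f b) ^ 2 := by gcongr
      _ = graphEnergy w f := by field_simp

theorem effCond_pos (hw : ∀ i j, 0 ≤ w i j) (hconn : IsConnectedW w) {a b : V} (hab : a ≠ b) :
    0 < effCond w a b := by
  obtain ⟨K, hK⟩ := exists_sq_sub_le_graphEnergy hw (hconn a b)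
  refine lt_of_lt_of_le (b := (|K| + 1)⁻¹) (by positivity) (le_effCond hab fun f ha hb => ?_)
  have h := hK f
  rw [ha, hb] at h
  rw [inv_le_iff_one_le_mul₀ (by positivity)]
  nlinarith [le_abs_self K, graphEnergy_nonneg hw f]

end Energy

/-- The energy splits over two vertex sets covering `V`, meeting in one vertex, and with no other
edges between them. -/
theorem graphEnergy_eq_add_of_cover {V : Type*} [Fintype V] {w : V → V → ℝ}
    (hsymm : ∀ i j, w i j = w j i) {A B : Set V} [Fintype A] [Fintype B] {v : V}
    (hunion : A ∪ B = Set.univ) (hinter : A ∩ B = {v})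
    (hsep : ∀ i ∈ A, ∀ j ∈ B, i ≠ v → j ≠ v → w i j = 0) (f : V → ℝ) :
    graphEnergy w f = graphEnergy (fun i j : A => w i j) (fun i => f i)
      + graphEnergy (fun i j : B => w i j) (fun i => f i) := by
  classical
  have hsum : ∀ (S : Set V) [Fintype S] (g : V → ℝ),
      ∑ i : S, g i = ∑ i : V, if i ∈ S then g i else 0 := by
    intro S _ g
    rw [Finset.sum_set_coe, ← Finset.sum_filter]
    exact Finset.sum_congr (by ext; simp) fun _ _ => rfl
  have hu : ∀ i, i ∈ A ∨ i ∈ B := fun i => (Set.ext_iff.1 hunion i).2 trivial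
  have hi : ∀ i, i ∈ A → i ∈ B → i = v := fun i ha hb => (Set.ext_iff.1 hinter i).1 ⟨ha, hb⟩
  obtain ⟨hvA, hvB⟩ : v ∈ A ∩ B := hinter ▸ rfl
  unfold graphEnergy
  rw [hsum A fun i => ∑ j : A, w i j * (f i - f j) ^ 2,
    hsum B fun i => ∑ j : B, w i j * (f i - f j) ^ 2, ← mul_add, ← Finset.sum_add_distrib]
  congr 1
  refine Finset.sum_congr rfl fun i _ => ?_
  rw [hsum A fun j => w i j * (f i - f j) ^ 2, hsum B fun j => w i j * (f i - f j) ^ 2]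
  have hterm : ∀ j, w i j * (f i - f j) ^ 2 =
      (if i ∈ A then if j ∈ A then w i j * (f i - f j) ^ 2 else 0 else 0)
      + if i ∈ B then if j ∈ B then w i j * (f i - f j) ^ 2 else 0 else 0 := by
    intro j
    have hzero : i = j → w i j * (f i - f j) ^ 2 = 0 := by
      rintro rfl
      simp
    clear hsum
    by_cases hiv : i = v <;> by_cases hjv : j = v <;>
      grind
  rw [Finset.sum_congr rfl fun j _ => hterm j, Finset.sum_add_distrib]
  by_cases hiA : i ∈ A <;> by_cases hiB : i ∈ B <;> simp [hiA, hiB]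

/-- **Series law for effective resistances.**
Let `(V, w)` be a finite connected weighted graph with `V = A ∪ B`, where `A ∩ B = {v}`
is a single vertex and there are no edges joining `A \ {v}` to `B \ {v}`.  Assume the
induced weighted graphs on `A` and `B` are connected.  If `w₁ ∈ A` and `w₂ ∈ B` with
`w₁ ≠ v ≠ w₂`, then `r(w₁, w₂) = ρ₁ + ρ₂`, where `ρ₁` is the effective resistance between
`w₁` and `v` in the induced graph on `A` and `ρ₂` that between `w₂` and `v` in the induced
graph on `B`. -/
theorem effRes_series
    {V : Type*} [Fintype V] [DecidableEq V] (w : V → V → ℝ)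
    (hsymm : ∀ i j, w i j = w j i) (hnonneg : ∀ i j, 0 ≤ w i j)
    (hdiag : ∀ i, w i i = 0) (hconn : IsConnectedW w)
    (A B : Set V) [DecidablePred (· ∈ A)] [DecidablePred (· ∈ B)]
    (v : V) (hvA : v ∈ A) (hvB : v ∈ B)
    (hunion : A ∪ B = Set.univ) (hinter : A ∩ B = {v})
    (hsep : ∀ i ∈ A, ∀ j ∈ B, i ≠ v → j ≠ v → w i j = 0)
    (hconnA : IsConnectedW (fun i j : A => w i j))
    (hconnB : IsConnectedW (fun i j : B => w i j))
    (w₁ : V) (hw₁ : w₁ ∈ A) (hw₁v : w₁ ≠ v)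
    (w₂ : V) (hw₂ : w₂ ∈ B) (hw₂v : w₂ ≠ v) :
    effRes w w₁ w₂ =
      effRes (fun i j : A => w i j) ⟨w₁, hw₁⟩ ⟨v, hvA⟩ +
      effRes (fun i j : B => w i j) ⟨w₂, hw₂⟩ ⟨v, hvB⟩ := by
  have hnnA : ∀ i j : A, 0 ≤ w i j := fun i j => hnonneg i j
  have hnnB : ∀ i j : B, 0 ≤ w i j := fun i j => hnonneg i j
  have hneA : (⟨w₁, hw₁⟩ : A) ≠ ⟨v, hvA⟩ := fun h => hw₁v (congrArg Subtype.val h)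
  have hneB : (⟨w₂, hw₂⟩ : B) ≠ ⟨v, hvB⟩ := fun h => hw₂v (congrArg Subtype.val h)
  have hi : ∀ i, i ∈ A → i ∈ B → i = v := fun i ha hb => (Set.ext_iff.1 hinter i).1 ⟨ha, hb⟩
  have hne : w₁ ≠ w₂ := fun h => hw₁v (hi w₁ hw₁ (h ▸ hw₂))
  have hsplit := graphEnergy_eq_add_of_cover hsymm hunion hinter hsep
  have hposA := effCond_pos hnnA hconnA hneA
  have hposB := effCond_pos hnnB hconnB hneB
  simp only [effRes_eq_inv_effCond]
  set α := effCond (fun i j : A => w i j) ⟨w₁, hw₁⟩ ⟨v, hvA⟩ with hα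
  set β := effCond (fun i j : B => w i j) ⟨w₂, hw₂⟩ ⟨v, hvB⟩ with hβ
  suffices h : effCond w w₁ w₂ = α * β / (α + β) by
    rw [h]
    field_simp
    ring
  apply le_antisymm
  · refine le_of_forall_pos_le_add fun ε hε => ?_
    obtain ⟨g, hg₁, hgv, hg⟩ := exists_graphEnergy_lt hneA (lt_add_of_pos_right α hε)
    obtain ⟨h, hh₂, hhv, hh⟩ := exists_graphEnergy_lt hneB (lt_add_of_pos_right β hε)
    -- At the cut vertex, `t` minimises `α * (1 - t) ^ 2 + β * t ^ 2`.
    set t := α / (α + β) with ht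
    let f : V → ℝ := fun i =>
      if hA : i ∈ A then t + (1 - t) * g ⟨i, hA⟩
      else if hB : i ∈ B then t + -t * h ⟨i, hB⟩ else 0
    have hfA : (fun i : A => f i) = fun i => t + (1 - t) * g i := by
      funext i
      simp [f]
    have hfB : (fun i : B => f i) = fun i => t + -t * h i := by
      funext i
      by_cases hA : (i : V) ∈ A
      · obtain rfl : i = ⟨v, hvB⟩ := Subtype.ext (hi i hA i.2)
        simp [f, hvA, hgv, hhv]
      · simp [f, hA]
    have hf₁ : f w₁ = 1 := (congrFun hfA ⟨w₁, hw₁⟩).trans (by rw [hg₁]; ring)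
    have hf₂ : f w₂ = 0 := (congrFun hfB ⟨w₂, hw₂⟩).trans (by rw [hh₂]; ring)
    have ht₀ : 0 ≤ t := by positivity
    have ht₁ : t ≤ 1 := div_le_one_of_le₀ (by linarith) (by positivity)
    calc effCond w w₁ w₂ ≤ graphEnergy w f := effCond_le_graphEnergy hnonneg hf₁ hf₂
      _ = (1 - t) ^ 2 * graphEnergy (fun i j : A => w i j) g
          + (-t) ^ 2 * graphEnergy (fun i j : B => w i j) h := by
        rw [hsplit, hfA, hfB, graphEnergy_const_add_mul, graphEnergy_const_add_mul]
      _ ≤ (1 - t) ^ 2 * (α + ε) + (-t) ^ 2 * (β + ε) := by gcongr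
      _ = ((1 - t) ^ 2 * α + t ^ 2 * β) + ((1 - t) ^ 2 + t ^ 2) * ε := by ring
      _ ≤ ((1 - t) ^ 2 * α + t ^ 2 * β) + 1 * ε := by
        gcongr
        nlinarith
      _ = α * β / (α + β) + ε := by
        rw [ht]
        field_simp
        ring
  · refine le_effCond hne fun f hf₁ hf₂ => ?_
    have hA := effCond_mul_sq_le_graphEnergy hnnA ⟨w₁, hw₁⟩ ⟨v, hvA⟩ (fun i => f i)
    have hB := effCond_mul_sq_le_graphEnergy hnnB ⟨w₂, hw₂⟩ ⟨v, hvB⟩ (fun i => f i)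
    simp only [← hα, ← hβ, hf₁, hf₂] at hA hB
    rw [hsplit, div_le_iff₀ (by positivity)]
    have hmin : α * β ≤ (α * (1 - f v) ^ 2 + β * (0 - f v) ^ 2) * (α + β) := by
      nlinarith [sq_nonneg (α * (1 - f v) - β * f v)]
    exact hmin.trans (by gcongr)
end

section
/- Let L be an n×n real symmetric positive semidefinite matrix (n ≥ 2) whose kernel is exactly the span of the all-ones vector J = (1,…,1), and let H be an n×n real matrix satisfying H·L = L·H = I − (1/n)·𝟙 and H·𝟙 = 0, where 𝟙 denotes the all-ones matrix (i.e. H is the Moore–Penrose pseudoinverse of L). Then Σ_{i<j} ⟨H(χ_i − χ_j), χ_i − χ_j⟩ = n · trace(H), where χ_k is the k-th standard basis vector of ℝ^n. Moreover trace(H) equals the sum of the reciprocals of the nonzero eigenvalues of L (counted with multiplicity). -/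
open Matrix

/-- For a matrix whose entries sum to zero, the quadratic form summed over the differences of
pairs of distinct standard basis vectors is the trace times the dimension. -/
theorem sum_lt_mulVec_single_sub_single {n : ℕ} (H : Matrix (Fin n) (Fin n) ℝ)
    (hsum : ∑ i, ∑ j, H i j = 0) :
    (∑ i : Fin n, ∑ j ∈ Finset.univ.filter (fun j : Fin n => i < j),
        H.mulVec (Pi.single i 1 - Pi.single j 1) ⬝ᵥ (Pi.single i 1 - Pi.single j 1))
      = n * H.trace := by
  set f : Fin n → Fin n → ℝ := fun i j => H i i + H j j - H i j - H j i with hf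
  have hterm : ∀ i j : Fin n,
      H.mulVec (Pi.single i 1 - Pi.single j 1) ⬝ᵥ (Pi.single i 1 - Pi.single j 1) = f i j := by
    intro i j
    simp only [hf, Matrix.mulVec_sub, dotProduct_sub, dotProduct_single,
      Matrix.mulVec_single_one, Pi.sub_apply, Matrix.col_apply, mul_one]
    ring
  simp only [hterm, Finset.sum_filter]
  have hswap : ∑ i, ∑ j, (if i < j then f i j else 0) =
      ∑ i, ∑ j, (if j < i then f i j else 0) := by
    rw [Finset.sum_comm]
    refine Finset.sum_congr rfl fun i _ => Finset.sum_congr rfl fun j _ => ?_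
    have : f j i = f i j := by simp only [hf]; ring
    rw [this]
  have hsplit : ∑ i, ∑ j, f i j = ∑ i, ∑ j, (if i < j then f i j else 0) +
      ∑ i, ∑ j, (if j < i then f i j else 0) := by
    simp only [← Finset.sum_add_distrib]
    refine Finset.sum_congr rfl fun i _ => Finset.sum_congr rfl fun j _ => ?_
    rcases lt_trichotomy i j with h | rfl | h
    · simp [h, h.not_gt]
    · simp [hf]
    · simp [h, h.not_gt]
  have hsum' : ∑ i, ∑ j, H j i = 0 := by rw [Finset.sum_comm, hsum]
  have htotal : ∑ i, ∑ j, f i j = 2 * (n * H.trace) := by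
    simp only [hf, Finset.sum_sub_distrib, Finset.sum_add_distrib, hsum, hsum', Matrix.trace,
      Matrix.diag_apply, Finset.sum_const, Finset.card_univ, Fintype.card_fin, nsmul_eq_mul,
      ← Finset.mul_sum]
    ring
  linarith

/-- The trace of the group inverse of a Hermitian matrix is the sum of the reciprocals of its
nonzero eigenvalues. -/
theorem trace_eq_sum_inv_eigenvalues {ι : Type*} [Fintype ι] [DecidableEq ι]
    {L H : Matrix ι ι ℝ} (hL : L.IsHermitian) (hcomm : L * H = H * L)
    (hLHL : L * H * L = L) (hHLH : H * L * H = H) :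
    H.trace = ∑ i ∈ Finset.univ.filter (fun i => hL.eigenvalues i ≠ 0),
        (hL.eigenvalues i)⁻¹ := by
  set U : Matrix ι ι ℝ := (hL.eigenvectorUnitary : Matrix ι ι ℝ)
  set D : Matrix ι ι ℝ := diagonal hL.eigenvalues with hD
  have hUU : star U * U = 1 := Unitary.coe_star_mul_self hL.eigenvectorUnitary
  have hUU' : U * star U = 1 := Unitary.coe_mul_star_self hL.eigenvectorUnitary
  have hspec : L = U * D * star U := by
    simpa [Unitary.conjStarAlgAut_apply, Function.comp_def] using hL.spectral_theorem
  set G : Matrix ι ι ℝ := star U * H * U with hG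
  have hconj : star U * L * U = D := by
    calc star U * L * U = (star U * U) * D * (star U * U) := by
          rw [hspec]; simp only [Matrix.mul_assoc]
      _ = D := by rw [hUU, Matrix.one_mul, Matrix.mul_one]
  have hmul : ∀ A B : Matrix ι ι ℝ,
      (star U * A * U) * (star U * B * U) = star U * (A * B) * U := by
    intro A B
    calc (star U * A * U) * (star U * B * U) = star U * A * (U * star U) * B * U := by
          simp only [Matrix.mul_assoc]
      _ = star U * (A * B) * U := by rw [hUU', Matrix.mul_one, Matrix.mul_assoc (star U)]
  have hDG : D * G = G * D := by rw [← hconj, hG, hmul, hmul, hcomm]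
  have hDGD : D * G * D = D := by rw [← hconj, hG, hmul, hmul, hLHL]
  have hGDG : G * D * G = G := by rw [← hconj, hG, hmul, hmul, hHLH]
  have htr : H.trace = G.trace := by
    rw [hG, Matrix.trace_mul_comm, ← Matrix.mul_assoc, hUU', Matrix.one_mul]
  rw [htr, Matrix.trace, Finset.sum_filter]
  refine Finset.sum_congr rfl fun i _ => ?_
  rw [Matrix.diag_apply]
  by_cases hi : hL.eigenvalues i = 0
  · have h := congrFun (congrFun hGDG i) i
    rw [← hDG, Matrix.mul_assoc, hD, Matrix.diagonal_mul, hi, zero_mul] at h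
    simp [hi, ← h]
  · have h := congrFun (congrFun hDGD i) i
    rw [hD, Matrix.mul_diagonal, Matrix.diagonal_mul, Matrix.diagonal_apply_eq] at h
    rw [if_pos hi]
    exact eq_inv_of_mul_eq_one_right (mul_right_cancel₀ hi (h.trans (one_mul _).symm))

/-- **Klein–Randić formula.**
Let `L` be an `n × n` (`n ≥ 2`) real symmetric positive semidefinite matrix whose kernel
is exactly the span of the all-ones vector, and let `H` be its Moore–Penrose
pseudoinverse, characterized by `H * L = L * H = I - (1/n) • 𝟙` (the orthogonal
projection onto the orthogonal complement of the all-ones vector, `𝟙` being the all-ones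
matrix) together with `H * 𝟙 = 0`.  Then
`Σ_{i<j} ⟨H(χ_i - χ_j), χ_i - χ_j⟩ = n * trace H`, and moreover `trace H` equals the sum
of the reciprocals of the nonzero eigenvalues of `L` (counted with multiplicity). -/
theorem kleinRandic_trace_pseudoinverse
    (n : ℕ) (hn : 2 ≤ n) (L H : Matrix (Fin n) (Fin n) ℝ)
    (hL : L.IsHermitian) (hpsd : L.PosSemidef)
    (hker : ∀ x : Fin n → ℝ, L.mulVec x = 0 ↔ ∃ t : ℝ, x = Function.const (Fin n) t)
    (hHL : H * L = 1 - (n : ℝ)⁻¹ • Matrix.of (fun _ _ => (1 : ℝ)))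
    (hLH : L * H = 1 - (n : ℝ)⁻¹ • Matrix.of (fun _ _ => (1 : ℝ)))
    (hH1 : H * Matrix.of (fun _ _ => (1 : ℝ)) = 0) :
    (∑ i : Fin n, ∑ j ∈ Finset.univ.filter (fun j : Fin n => i < j),
        H.mulVec (Pi.single i 1 - Pi.single j 1) ⬝ᵥ (Pi.single i 1 - Pi.single j 1))
      = n * H.trace ∧
    H.trace = ∑ i ∈ Finset.univ.filter (fun i : Fin n => hL.eigenvalues i ≠ 0),
        (hL.eigenvalues i)⁻¹ := by
  have hrow : ∀ i, ∑ j, H i j = 0 := fun i => by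
    simpa [Matrix.mul_apply] using
      congrFun (congrFun hH1 i) (⟨0, by omega⟩ : Fin n)
  have hL1 : L * Matrix.of (fun _ _ => (1 : ℝ)) = 0 := by
    ext i j
    have h := congrFun ((hker (Function.const (Fin n) 1)).2 ⟨1, rfl⟩) i
    simpa [Matrix.mul_apply, Matrix.mulVec, dotProduct] using h
  refine ⟨sum_lt_mulVec_single_sub_single H (by simp [hrow]),
    trace_eq_sum_inv_eigenvalues hL (hLH.trans hHL.symm) ?_ ?_⟩
  · rw [Matrix.mul_assoc, hHL, Matrix.mul_sub, Matrix.mul_smul, hL1, smul_zero, sub_zero,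
      Matrix.mul_one]
  · rw [Matrix.mul_assoc, hLH, Matrix.mul_sub, Matrix.mul_smul, hH1, smul_zero, sub_zero,
      Matrix.mul_one]
end

section
/- Let c₁, c₂ > 0 be edge weights on the path P₃ satisfying 1/c₁ + 1/c₂ = 2. Then the algebraic connectivity satisfies λ₂(c₁,c₂) ≤ 1, with equality if and only if c₁ = c₂ = 1. -/
open Matrix

/-- The Laplacian of the weighted path `P₃` with edge weights `c₁, c₂`. -/
noncomputable def lapP3 (c₁ c₂ : ℝ) : Matrix (Fin 3) (Fin 3) ℝ :=
  !![c₁, -c₁, 0; -c₁, c₁ + c₂, -c₂; 0, -c₂, c₂]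

/-- The algebraic connectivity `λ₂` of the weighted path `P₃`: the minimum (here: infimum,
which is attained) of the Rayleigh quotient `⟨Lx, x⟩ / ⟨x, x⟩` over nonzero `x ∈ ℝ³` with
`x₁ + x₂ + x₃ = 0`; equivalently, the second smallest eigenvalue of the Laplacian. -/
noncomputable def lambda2P3 (c₁ c₂ : ℝ) : ℝ :=
  sInf {R : ℝ | ∃ x : Fin 3 → ℝ, x ≠ 0 ∧ x 0 + x 1 + x 2 = 0 ∧
    R = ((lapP3 c₁ c₂).mulVec x ⬝ᵥ x) / (x ⬝ᵥ x)}

lemma lapP3_mulVec_dotProduct_self (c₁ c₂ : ℝ) (x : Fin 3 → ℝ) :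
    (lapP3 c₁ c₂).mulVec x ⬝ᵥ x = c₁ * (x 0 - x 1) ^ 2 + c₂ * (x 1 - x 2) ^ 2 := by
  simp [lapP3, Matrix.mulVec, dotProduct, Fin.sum_univ_three]
  ring

lemma lambda2P3_le_rayleigh {c₁ c₂ : ℝ} (hc₁ : 0 ≤ c₁) (hc₂ : 0 ≤ c₂) {x : Fin 3 → ℝ}
    (hx : x ≠ 0) (hsum : x 0 + x 1 + x 2 = 0) :
    lambda2P3 c₁ c₂ ≤ ((lapP3 c₁ c₂).mulVec x ⬝ᵥ x) / (x ⬝ᵥ x) := by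
  refine csInf_le ⟨0, ?_⟩ ⟨x, hx, hsum, rfl⟩
  rintro _ ⟨y, -, -, rfl⟩
  rw [lapP3_mulVec_dotProduct_self, dotProduct, Fin.sum_univ_three]
  exact div_nonneg (by positivity)
    (add_nonneg (add_nonneg (mul_self_nonneg _) (mul_self_nonneg _)) (mul_self_nonneg _))

/-- The test vector whose increments along the edges are the resistances `1 / c₁`, `1 / c₂`. -/
lemma lambda2P3_le_of_resistance_eq_two {c₁ c₂ : ℝ} (hc₁ : 0 < c₁) (hc₂ : 0 < c₂)
    (hres : 1 / c₁ + 1 / c₂ = 2) :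
    lambda2P3 c₁ c₂ ≤ 3 / (3 + (1 / c₁ - 1) ^ 2) := by
  obtain ⟨a, ha⟩ : ∃ a, a = 1 / c₁ := ⟨_, rfl⟩
  have hb : 1 / c₂ = 2 - a := by linarith
  have h₁ : c₁ * a = 1 := by rw [ha]; field_simp
  have h₂ : c₂ * (2 - a) = 1 := by rw [← hb]; field_simp
  have ha₀ : 0 < a := by rw [ha]; positivity
  let x : Fin 3 → ℝ := ![(a + 2) / 3, (2 - 2 * a) / 3, (a - 4) / 3]
  have hx : x ≠ 0 := fun h => by
    have := congrFun h 0
    simp [x] at this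
    linarith
  have hsum : x 0 + x 1 + x 2 = 0 := by simp [x]; ring
  have hnum : (lapP3 c₁ c₂).mulVec x ⬝ᵥ x = 2 := by
    rw [lapP3_mulVec_dotProduct_self]
    simp [x]
    linear_combination a * h₁ + (2 - a) * h₂
  have hden : x ⬝ᵥ x = 2 / 3 * (3 + (a - 1) ^ 2) := by
    simp [x, dotProduct, Fin.sum_univ_three]
    ring
  refine (lambda2P3_le_rayleigh hc₁.le hc₂.le hx hsum).trans_eq ?_
  rw [hnum, hden, ← ha]
  field_simp

lemma one_le_lambda2P3_one_one : 1 ≤ lambda2P3 1 1 := by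
  refine le_csInf ⟨_, ![1, 0, -1], fun h => ?_, by simp, rfl⟩ ?_
  · simpa using congrFun h 0
  · rintro _ ⟨x, hx, hsum, rfl⟩
    have hpos : 0 < x ⬝ᵥ x :=
      lt_of_le_of_ne (Finset.sum_nonneg fun i _ => mul_self_nonneg (x i))
        fun h => hx (dotProduct_self_eq_zero.mp h.symm)
    rw [one_le_div hpos, lapP3_mulVec_dotProduct_self, dotProduct, Fin.sum_univ_three]
    have h₂ : x 2 = -x 0 - x 1 := by linarith
    rw [h₂]
    nlinarith [sq_nonneg (x 1)]

/-- **Optimal weights for `P₃` at fixed total effective resistance.**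
If `c₁, c₂ > 0` are edge weights on the path `P₃` with `1/c₁ + 1/c₂ = 2`, then the
algebraic connectivity satisfies `λ₂(c₁, c₂) ≤ 1`, with equality iff `c₁ = c₂ = 1`. -/
theorem lambda2P3_le_one_of_resistance_eq_two
    (c₁ c₂ : ℝ) (hc₁ : 0 < c₁) (hc₂ : 0 < c₂) (hres : 1 / c₁ + 1 / c₂ = 2) :
    lambda2P3 c₁ c₂ ≤ 1 ∧ (lambda2P3 c₁ c₂ = 1 ↔ c₁ = 1 ∧ c₂ = 1) := by
  have hle := lambda2P3_le_of_resistance_eq_two hc₁ hc₂ hres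
  have hone : lambda2P3 c₁ c₂ ≤ 1 := hle.trans <| by
    rw [div_le_one (by positivity)]
    linarith [sq_nonneg (1 / c₁ - 1)]
  refine ⟨hone, fun h => ?_, ?_⟩
  · rw [h, le_div_iff₀ (by positivity)] at hle
    have hsq : (1 / c₁ - 1) ^ 2 = 0 := le_antisymm (by linarith) (sq_nonneg _)
    have h₁ : 1 / c₁ = 1 := sub_eq_zero.mp (pow_eq_zero_iff two_ne_zero |>.mp hsq)
    have h₂ : 1 / c₂ = 1 := by linarith
    rw [one_div, inv_eq_one] at h₁ h₂
    exact ⟨h₁, h₂⟩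
  · rintro ⟨rfl, rfl⟩
    exact le_antisymm hone one_le_lambda2P3_one_one
end

section
/- Let c₁, c₂, c₃ > 0 be edge weights on the path P₄ and let d = 2c₁c₃/(c₁+c₃) be the harmonic mean of c₁ and c₃. Then λ₂(c₁, c₂, c₃) ≤ λ₂(d, c₂, d), where λ₂(a,b,c) denotes the algebraic connectivity of P₄ with edge weights a, b, c. -/
open Matrix

/-- The Laplacian of the weighted path `P₄` with edge weights `c₁, c₂, c₃`. -/
noncomputable def lapP4 (c₁ c₂ c₃ : ℝ) : Matrix (Fin 4) (Fin 4) ℝ :=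
  !![c₁, -c₁, 0, 0; -c₁, c₁ + c₂, -c₂, 0; 0, -c₂, c₂ + c₃, -c₃; 0, 0, -c₃, c₃]

/-- The algebraic connectivity `λ₂` of the weighted path `P₄`: the minimum (here: infimum,
which is attained) of the Rayleigh quotient `⟨Lx, x⟩ / ⟨x, x⟩` over nonzero `x ∈ ℝ⁴` with
`x₁ + x₂ + x₃ + x₄ = 0`; equivalently, the second smallest eigenvalue of the Laplacian. -/
noncomputable def lambda2P4 (c₁ c₂ c₃ : ℝ) : ℝ :=
  sInf {R : ℝ | ∃ x : Fin 4 → ℝ, x ≠ 0 ∧ x 0 + x 1 + x 2 + x 3 = 0 ∧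
    R = ((lapP4 c₁ c₂ c₃).mulVec x ⬝ᵥ x) / (x ⬝ᵥ x)}

lemma lapP4_mulVec_dotProduct (c₁ c₂ c₃ : ℝ) (x : Fin 4 → ℝ) :
    (lapP4 c₁ c₂ c₃).mulVec x ⬝ᵥ x =
      c₁ * (x 0 - x 1) ^ 2 + c₂ * (x 1 - x 2) ^ 2 + c₃ * (x 2 - x 3) ^ 2 := by
  simp [lapP4, Matrix.mulVec, dotProduct, Fin.sum_univ_four]
  ring

lemma dotProduct_self_nonneg {n : Type*} [Fintype n] (x : n → ℝ) : 0 ≤ x ⬝ᵥ x :=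
  Finset.sum_nonneg fun i _ => mul_self_nonneg (x i)

lemma lapP4_rayleigh_nonneg {c₁ c₂ c₃ : ℝ} (hc₁ : 0 < c₁) (hc₂ : 0 < c₂) (hc₃ : 0 < c₃)
    (x : Fin 4 → ℝ) : 0 ≤ ((lapP4 c₁ c₂ c₃).mulVec x ⬝ᵥ x) / (x ⬝ᵥ x) := by
  rw [lapP4_mulVec_dotProduct]
  have : 0 ≤ x ⬝ᵥ x := dotProduct_self_nonneg x
  positivity

lemma lambda2P4_nonneg {c₁ c₂ c₃ : ℝ} (hc₁ : 0 < c₁) (hc₂ : 0 < c₂) (hc₃ : 0 < c₃) :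
    0 ≤ lambda2P4 c₁ c₂ c₃ := by
  refine Real.sInf_nonneg ?_
  rintro _ ⟨x, -, -, rfl⟩
  exact lapP4_rayleigh_nonneg hc₁ hc₂ hc₃ x

lemma lambda2P4_mul_dotProduct_le {c₁ c₂ c₃ : ℝ} (hc₁ : 0 < c₁) (hc₂ : 0 < c₂) (hc₃ : 0 < c₃)
    (x : Fin 4 → ℝ) (hx : x 0 + x 1 + x 2 + x 3 = 0) :
    lambda2P4 c₁ c₂ c₃ * (x ⬝ᵥ x) ≤ (lapP4 c₁ c₂ c₃).mulVec x ⬝ᵥ x := by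
  rcases eq_or_ne x 0 with rfl | h0
  · simp
  have hpos : 0 < x ⬝ᵥ x :=
    lt_of_le_of_ne (dotProduct_self_nonneg x) fun h => h0 (dotProduct_self_eq_zero.mp h.symm)
  rw [← le_div_iff₀ hpos]
  refine csInf_le ⟨0, ?_⟩ ⟨x, h0, hx, rfl⟩
  rintro _ ⟨y, -, -, rfl⟩
  exact lapP4_rayleigh_nonneg hc₁ hc₂ hc₃ y

lemma le_lambda2P4 {c₁ c₂ c₃ μ : ℝ}
    (h : ∀ x : Fin 4 → ℝ, x 0 + x 1 + x 2 + x 3 = 0 →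
      μ * (x ⬝ᵥ x) ≤ (lapP4 c₁ c₂ c₃).mulVec x ⬝ᵥ x) :
    μ ≤ lambda2P4 c₁ c₂ c₃ := by
  refine le_csInf ⟨_, ![1, -1, 0, 0], fun h => ?_, by simp, rfl⟩ ?_
  · simpa using congrFun h 0
  rintro _ ⟨x, h0, hx, rfl⟩
  have hpos : 0 < x ⬝ᵥ x :=
    lt_of_le_of_ne (dotProduct_self_nonneg x) fun h => h0 (dotProduct_self_eq_zero.mp h.symm)
  exact (le_div_iff₀ hpos).mpr (h x hx)

/-- If `N² ≤ A * Q` and `μ * A ≤ N`, then `μ * N ≤ Q`. -/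
lemma mul_le_of_sq_le_mul {μ N A Q : ℝ} (hμ : 0 ≤ μ) (hN : 0 ≤ N) (hQ : 0 ≤ Q)
    (hsq : N ^ 2 ≤ A * Q) (hA : μ * A ≤ N) : μ * N ≤ Q := by
  rcases hN.eq_or_lt with rfl | hN
  · simpa using hQ
  · refine le_of_mul_le_mul_right ?_ hN
    calc μ * N * N = μ * N ^ 2 := by ring
      _ ≤ μ * (A * Q) := mul_le_mul_of_nonneg_left hsq hμ
      _ = μ * A * Q := by ring
      _ ≤ N * Q := mul_le_mul_of_nonneg_right hA hQ
      _ = Q * N := mul_comm N Q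

/-- The dual bound for edge flows `(a, b, e)`: the Laplacian `B C Bᵀ` and the edge matrix
`C^(1/2) Bᵀ B C^(1/2)` have the same nonzero spectrum. -/
lemma lambda2P4_mul_flow_le {c₁ c₂ c₃ : ℝ} (hc₁ : 0 < c₁) (hc₂ : 0 < c₂) (hc₃ : 0 < c₃)
    (a b e : ℝ) :
    lambda2P4 c₁ c₂ c₃ * (a ^ 2 / c₁ + b ^ 2 / c₂ + e ^ 2 / c₃) ≤
      a ^ 2 + (b - a) ^ 2 + (e - b) ^ 2 + e ^ 2 := by
  obtain ⟨s, rfl⟩ : ∃ s, a = c₁ * s := ⟨a / c₁, by field_simp⟩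
  obtain ⟨t, rfl⟩ : ∃ t, b = c₂ * t := ⟨b / c₂, by field_simp⟩
  obtain ⟨u, rfl⟩ : ∃ u, e = c₃ * u := ⟨e / c₃, by field_simp⟩
  have hN : (c₁ * s) ^ 2 / c₁ + (c₂ * t) ^ 2 / c₂ + (c₃ * u) ^ 2 / c₃ =
      c₁ * s ^ 2 + c₂ * t ^ 2 + c₃ * u ^ 2 := by
    field_simp
  rw [hN]
  set x : Fin 4 → ℝ := ![(3 * s + 2 * t + u) / 4, (-s + 2 * t + u) / 4,
    (-s - 2 * t + u) / 4, (-s - 2 * t - 3 * u) / 4] with hx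
  have hray := lambda2P4_mul_dotProduct_le hc₁ hc₂ hc₃ x (by simp [hx]; ring)
  have hcs := Finset.sum_mul_sq_le_sq_mul_sq Finset.univ x
    ![c₁ * s, c₂ * t - c₁ * s, c₃ * u - c₂ * t, -(c₃ * u)]
  refine mul_le_of_sq_le_mul (A := x ⬝ᵥ x) (lambda2P4_nonneg hc₁ hc₂ hc₃) (by positivity)
    (by positivity) ?_ ?_
  · simp [dotProduct, Fin.sum_univ_four, hx] at hcs ⊢
    refine (le_of_eq_of_le ?_ hcs).trans_eq ?_ <;> ring
  · rw [lapP4_mulVec_dotProduct] at hray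
    refine hray.trans_eq ?_
    simp [hx]
    ring

/-- A lower bound in terms of edge flows is a lower bound for the algebraic connectivity. -/
lemma le_lambda2P4_of_flow {c₁ c₂ c₃ μ : ℝ} (hc₁ : 0 < c₁) (hc₂ : 0 < c₂) (hc₃ : 0 < c₃)
    (hμ : 0 ≤ μ)
    (h : ∀ a b e : ℝ, μ * (a ^ 2 / c₁ + b ^ 2 / c₂ + e ^ 2 / c₃) ≤
      a ^ 2 + (b - a) ^ 2 + (e - b) ^ 2 + e ^ 2) :
    μ ≤ lambda2P4 c₁ c₂ c₃ := by
  refine le_lambda2P4 fun x hx => ?_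
  have hx3 : x 3 = -(x 0 + x 1 + x 2) := by linarith
  have hflow := h (x 0) (x 0 + x 1) (x 0 + x 1 + x 2)
  have hcs := Finset.sum_sq_le_sum_mul_sum_of_sq_le_mul Finset.univ
    (r := ![x 0 * (x 0 - x 1), (x 0 + x 1) * (x 1 - x 2), (x 0 + x 1 + x 2) * (x 2 - x 3)])
    (f := ![x 0 ^ 2 / c₁, (x 0 + x 1) ^ 2 / c₂, (x 0 + x 1 + x 2) ^ 2 / c₃])
    (g := ![c₁ * (x 0 - x 1) ^ 2, c₂ * (x 1 - x 2) ^ 2, c₃ * (x 2 - x 3) ^ 2])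
    (by intro i _; fin_cases i <;> simp <;> positivity)
    (by intro i _; fin_cases i <;> simp <;> positivity)
    (by intro i _; fin_cases i <;> simp <;> field_simp <;> exact le_rfl)
  rw [lapP4_mulVec_dotProduct]
  refine mul_le_of_sq_le_mul hμ (dotProduct_self_nonneg x) (by positivity)
    (A := x 0 ^ 2 / c₁ + (x 0 + x 1) ^ 2 / c₂ + (x 0 + x 1 + x 2) ^ 2 / c₃) ?_ ?_
  · simp only [Fin.sum_univ_three, Matrix.cons_val] at hcs
    refine le_of_eq_of_le ?_ hcs
    simp only [dotProduct, Fin.sum_univ_four, hx3]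
    ring
  · refine hflow.trans_eq ?_
    simp only [dotProduct, Fin.sum_univ_four, hx3]
    ring

/-- **Symmetrizing the outer weights of `P₄` does not decrease the algebraic connectivity.**
Let `c₁, c₂, c₃ > 0` be edge weights on the path `P₄` and let `d = 2c₁c₃/(c₁ + c₃)` be the
harmonic mean of `c₁` and `c₃`.  Then `λ₂(c₁, c₂, c₃) ≤ λ₂(d, c₂, d)`. -/
theorem lambda2P4_le_harmonicMean_symmetrization
    (c₁ c₂ c₃ : ℝ) (hc₁ : 0 < c₁) (hc₂ : 0 < c₂) (hc₃ : 0 < c₃) :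
    lambda2P4 c₁ c₂ c₃ ≤
      lambda2P4 (2 * c₁ * c₃ / (c₁ + c₃)) c₂ (2 * c₁ * c₃ / (c₁ + c₃)) := by
  have hd : 0 < 2 * c₁ * c₃ / (c₁ + c₃) := by positivity
  refine le_lambda2P4_of_flow hd hc₂ hd (lambda2P4_nonneg hc₁ hc₂ hc₃) fun a b e => ?_
  have hsymm := lambda2P4_mul_flow_le hc₁ hc₂ hc₃ ((a + e) / 2) b ((a + e) / 2)
  have hanti := lambda2P4_mul_flow_le hc₁ hc₂ hc₃ ((a - e) / 2) 0 ((a - e) / 2)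
  refine le_of_eq_of_le ?_ ((add_le_add hsymm hanti).trans_eq ?_)
  · rw [← mul_add]
    congr 1
    field_simp
    ring
  · ring
end

section
/- Let r₀ = (5/13)(3 + 1/√3) and consider the path P₄ with edge weights c₁ = c₃ = 1/r₀ and c₂ = 2/(5 − 3r₀). These weights satisfy 3/c₁ + 4/c₂ + 3/c₃ = 10, and the algebraic connectivity attains the maximal value λ₂(c₁,c₂,c₃) = 2 − (4√3)/5. Hence the maximum of λ₂ over all positive weights with total effective resistance 10 equals 2 − (4√3)/5, and this maximum is attained only at these weights. -/
open Matrix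

/-- The value of the Rayleigh quotient of `lapP4` in coordinates. -/
theorem lapP4_rayleigh_eq (c₁ c₂ c₃ : ℝ) (x : Fin 4 → ℝ) :
    ((lapP4 c₁ c₂ c₃).mulVec x ⬝ᵥ x) / (x ⬝ᵥ x) =
      (c₁ * (x 0 - x 1) ^ 2 + c₂ * (x 1 - x 2) ^ 2 + c₃ * (x 2 - x 3) ^ 2) /
        (x 0 ^ 2 + x 1 ^ 2 + x 2 ^ 2 + x 3 ^ 2) := by
  congr 1
  · simp [lapP4, Matrix.mulVec, dotProduct, Fin.sum_univ_four]
    ring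
  · simp [dotProduct, Fin.sum_univ_four]
    ring

theorem sum_sq_pos_of_ne_zero {x : Fin 4 → ℝ} (hx : x ≠ 0) :
    0 < x 0 ^ 2 + x 1 ^ 2 + x 2 ^ 2 + x 3 ^ 2 := by
  obtain ⟨i, hi⟩ := Function.ne_iff.mp hx
  have hi' : 0 < x i ^ 2 := sq_pos_of_ne_zero hi
  fin_cases i <;> simp at hi' <;> positivity

/-- Any admissible vector gives an upper bound for `lambda2P4`. -/
theorem lambda2P4_le_rayleigh {c₁ c₂ c₃ : ℝ} (h₁ : 0 < c₁) (h₂ : 0 < c₂) (h₃ : 0 < c₃)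
    {x : Fin 4 → ℝ} (hx : x ≠ 0) (hsum : x 0 + x 1 + x 2 + x 3 = 0) :
    lambda2P4 c₁ c₂ c₃ ≤
      (c₁ * (x 0 - x 1) ^ 2 + c₂ * (x 1 - x 2) ^ 2 + c₃ * (x 2 - x 3) ^ 2) /
        (x 0 ^ 2 + x 1 ^ 2 + x 2 ^ 2 + x 3 ^ 2) := by
  refine csInf_le ⟨0, ?_⟩ ⟨x, hx, hsum, (lapP4_rayleigh_eq c₁ c₂ c₃ x).symm⟩
  rintro R ⟨y, -, -, rfl⟩
  rw [lapP4_rayleigh_eq]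
  positivity

/-- A lower bound on the quadratic form on mean-zero vectors bounds `lambda2P4` from below. -/
theorem le_lambda2P4_s16 {c₁ c₂ c₃ l : ℝ}
    (h : ∀ x₀ x₁ x₂ x₃ : ℝ, x₀ + x₁ + x₂ + x₃ = 0 →
      l * (x₀ ^ 2 + x₁ ^ 2 + x₂ ^ 2 + x₃ ^ 2) ≤
        c₁ * (x₀ - x₁) ^ 2 + c₂ * (x₁ - x₂) ^ 2 + c₃ * (x₂ - x₃) ^ 2) :
    l ≤ lambda2P4 c₁ c₂ c₃ := by
  refine le_csInf ⟨_, ![1, -1, 0, 0], ?_, by simp, rfl⟩ ?_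
  · intro h0
    simpa using congrFun h0 0
  · rintro R ⟨x, hx, hsum, rfl⟩
    rw [lapP4_rayleigh_eq, le_div_iff₀ (sum_sq_pos_of_ne_zero hx)]
    exact h _ _ _ _ hsum

/-- Upper bound for `lambda2P4` from the potential whose edge currents are `√3, 2, √3`, together
with the equality case, in terms of the resistances `r₁, r₂, r₃`. -/
theorem lambda2P4_inv_le {s r₁ r₂ r₃ : ℝ} (hs : s ^ 2 = 3) (h₁ : 0 < r₁) (h₂ : 0 < r₂)
    (h₃ : 0 < r₃) (hr : 3 * r₁ + 4 * r₂ + 3 * r₃ = 10) :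
    lambda2P4 r₁⁻¹ r₂⁻¹ r₃⁻¹ ≤ 2 - 4 * s / 5 ∧
      (lambda2P4 r₁⁻¹ r₂⁻¹ r₃⁻¹ = 2 - 4 * s / 5 →
        s * r₁ * (2 - 4 * s / 5) = 2 * s - 2 ∧ r₂ * (2 - 4 * s / 5) = 2 - s ∧
          s * r₃ * (2 - 4 * s / 5) = 2 * s - 2) := by
  obtain ⟨x₀, x₁, x₂, x₃, hsum, e₁, e₂, e₃⟩ : ∃ x₀ x₁ x₂ x₃ : ℝ, x₀ + x₁ + x₂ + x₃ = 0 ∧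
      x₀ - x₁ = s * r₁ ∧ x₁ - x₂ = 2 * r₂ ∧ x₂ - x₃ = s * r₃ :=
    ⟨(3 * (s * r₁) + 2 * (2 * r₂) + s * r₃) / 4, (-(s * r₁) + 2 * (2 * r₂) + s * r₃) / 4,
      (-(s * r₁) - 2 * (2 * r₂) + s * r₃) / 4, (-(s * r₁) - 2 * (2 * r₂) - 3 * (s * r₃)) / 4,
      by ring, by ring, by ring, by ring⟩
  have hne : ![x₀, x₁, x₂, x₃] ≠ 0 := by
    intro h
    have k₁ : x₁ = 0 := by simpa using congrFun h 1
    have k₂ : x₂ = 0 := by simpa using congrFun h 2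
    linarith
  have hD := sum_sq_pos_of_ne_zero hne
  have hle := lambda2P4_le_rayleigh (inv_pos.2 h₁) (inv_pos.2 h₂) (inv_pos.2 h₃) hne
    (by simpa using hsum)
  simp only [cons_val] at hD hle
  have hN : r₁⁻¹ * (x₀ - x₁) ^ 2 + r₂⁻¹ * (x₁ - x₂) ^ 2 + r₃⁻¹ * (x₂ - x₃) ^ 2 = 10 := by
    rw [e₁, e₂, e₃]
    field_simp
    rw [hs]
    linarith
  rw [hN] at hle
  set D := x₀ ^ 2 + x₁ ^ 2 + x₂ ^ 2 + x₃ ^ 2 with hDdef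
  set l := 2 - 4 * s / 5 with hl
  have hl0 : 0 < l := by nlinarith
  have hg : s * x₀ + (2 - s) * x₁ + (s - 2) * x₂ - s * x₃ = 10 := by
    linear_combination s * e₁ + 2 * e₂ + s * e₃ + (r₁ + r₃) * hs + hr
  have key : (l * x₀ - s) ^ 2 + (l * x₁ - (2 - s)) ^ 2 + (l * x₂ - (s - 2)) ^ 2 +
      (l * x₃ + s) ^ 2 = l * (l * D - 10) := by
    rw [hDdef]
    linear_combination (-2 * l) * hg + 4 * hs - 10 * hl
  have hlD : 0 ≤ l * D - 10 := by
    refine nonneg_of_mul_nonneg_right ?_ hl0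
    rw [← key]
    positivity
  have hdiv : 10 / D ≤ l := by
    rw [div_le_iff₀ hD]
    linarith
  refine ⟨hle.trans hdiv, fun heq => ?_⟩
  rw [heq, le_div_iff₀ hD] at hle
  rw [show l * D - 10 = 0 by linarith, mul_zero] at key
  have p₀ := sq_nonneg (l * x₀ - s)
  have p₁ := sq_nonneg (l * x₁ - (2 - s))
  have p₂ := sq_nonneg (l * x₂ - (s - 2))
  have p₃ := sq_nonneg (l * x₃ + s)
  have k₀ : l * x₀ - s = 0 := sq_eq_zero_iff.1 (by linarith)
  have k₁ : l * x₁ - (2 - s) = 0 := sq_eq_zero_iff.1 (by linarith)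
  have k₂ : l * x₂ - (s - 2) = 0 := sq_eq_zero_iff.1 (by linarith)
  have k₃ : l * x₃ + s = 0 := sq_eq_zero_iff.1 (by linarith)
  refine ⟨?_, ?_, ?_⟩
  · linear_combination k₀ - k₁ - l * e₁
  · linear_combination (k₁ - k₂ - l * e₂) / 2
  · linear_combination k₂ - k₃ - l * e₃

/-- **The maximizing weights for `P₄` with total effective resistance `10`.**
Let `r₀ = (5/13)(3 + 1/√3)` and consider the path `P₄` with edge weights
`c₁ = c₃ = 1/r₀` and `c₂ = 2/(5 - 3r₀)`.  These weights satisfy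
`3/c₁ + 4/c₂ + 3/c₃ = 10`, and the algebraic connectivity attains the maximal value
`λ₂ = 2 - 4√3/5`.  Hence the maximum of `λ₂` over all positive weights with total
effective resistance `10` equals `2 - 4√3/5`, and it is attained only at these weights. -/
theorem lambda2P4_max_characterization :
    let r₀ : ℝ := (5 / 13) * (3 + 1 / Real.sqrt 3)
    let d : ℝ := 1 / r₀
    let e : ℝ := 2 / (5 - 3 * r₀)
    (3 / d + 4 / e + 3 / d = 10) ∧
    lambda2P4 d e d = 2 - 4 * Real.sqrt 3 / 5 ∧
    (∀ c₁ c₂ c₃ : ℝ, 0 < c₁ → 0 < c₂ → 0 < c₃ →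
      3 / c₁ + 4 / c₂ + 3 / c₃ = 10 →
      lambda2P4 c₁ c₂ c₃ ≤ 2 - 4 * Real.sqrt 3 / 5 ∧
      (lambda2P4 c₁ c₂ c₃ = 2 - 4 * Real.sqrt 3 / 5 →
        c₁ = d ∧ c₂ = e ∧ c₃ = d)) := by
  obtain ⟨s, hs⟩ : ∃ s, s = Real.sqrt 3 := ⟨_, rfl⟩
  have hs2 : s ^ 2 = 3 := by rw [hs]; exact Real.sq_sqrt (by norm_num)
  have hs0 : 0 < s := by rw [hs]; positivity
  rw [← hs]
  have hs17 : 17 / 10 < s := by nlinarith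
  have hs18 : s < 9 / 5 := by nlinarith
  intro r₀ d e
  have hr₀ : r₀ = (45 + 5 * s) / 39 := by
    simp only [r₀]
    field_simp
    linear_combination -65 * hs2
  have hd : d = (9 - s) / 10 := by
    simp only [d]
    rw [hr₀, div_eq_iff (by positivity)]
    linear_combination (5 / 390) * hs2
  have he : e = (8 + 2 * s) / 5 := by
    simp only [e]
    rw [hr₀, div_eq_iff (by linarith)]
    linear_combination (2 / 13) * hs2
  have hd0 : 0 < d := by rw [hd]; linarith
  have he0 : 0 < e := by rw [he]; positivity
  have hsum : 3 / d + 4 / e + 3 / d = 10 := by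
    simp only [d, e]
    rw [one_div, div_inv_eq_mul, div_div_eq_mul_div]
    ring
  have hmax : ∀ c₁ c₂ c₃ : ℝ, 0 < c₁ → 0 < c₂ → 0 < c₃ → 3 / c₁ + 4 / c₂ + 3 / c₃ = 10 →
      lambda2P4 c₁ c₂ c₃ ≤ 2 - 4 * s / 5 ∧
      (lambda2P4 c₁ c₂ c₃ = 2 - 4 * s / 5 → c₁ = d ∧ c₂ = e ∧ c₃ = d) := by
    intro c₁ c₂ c₃ h₁ h₂ h₃ h
    have hb := lambda2P4_inv_le hs2 (inv_pos.2 h₁) (inv_pos.2 h₂) (inv_pos.2 h₃)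
      (by simpa only [div_eq_mul_inv] using h)
    simp only [inv_inv] at hb
    refine ⟨hb.1, fun heq => ?_⟩
    obtain ⟨q₁, q₂, q₃⟩ := hb.2 heq
    have outer : ∀ c : ℝ, 0 < c → s * c⁻¹ * (2 - 4 * s / 5) = 2 * s - 2 → c = d := by
      intro c hc q
      field_simp at q
      rw [hd]
      have hq : (s - 1) * c = (s - 1) * ((9 - s) / 10) := by
        linear_combination (-1 / 10) * q - (3 / 10) * hs2
      exact mul_left_cancel₀ (by linarith) hq
    refine ⟨outer c₁ h₁ q₁, ?_, outer c₃ h₃ q₃⟩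
    field_simp at q₂
    rw [he]
    have hq : (2 - s) * c₂ = (2 - s) * ((8 + 2 * s) / 5) := by
      linear_combination (-1 / 5) * q₂ + (2 / 5) * hs2
    exact mul_left_cancel₀ (by linarith) hq
  refine ⟨hsum, le_antisymm (hmax d e d hd0 he0 hd0 hsum).1 (le_lambda2P4_s16 ?_), hmax⟩
  intro x₀ x₁ x₂ x₃ hx
  obtain rfl : x₃ = -(x₀ + x₁ + x₂) := by linarith
  rw [hd, he, ← sub_nonneg]
  have hantisymm : 0 ≤ (7 * s - 11) / 10 *
      ((2 * x₀ + x₁ + x₂) / 2 - (3 + 2 * s) * ((x₁ - x₂) / 2)) ^ 2 :=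
    mul_nonneg (by linarith) (sq_nonneg _)
  have hsymm : 0 ≤ (12 * s - 4) / 10 * ((x₁ + x₂) / 2) ^ 2 :=
    mul_nonneg (by linarith) (sq_nonneg _)
  refine (add_nonneg (mul_nonneg zero_le_two hantisymm)
    (mul_nonneg zero_le_two hsymm)).trans_eq ?_
  linear_combination (-(28 / 5) * ((2 * x₀ + x₁ + x₂) / 2) * ((x₁ - x₂) / 2) +
    (28 * s + 40) / 5 * ((x₁ - x₂) / 2) ^ 2) * hs2
end
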